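/- For μ, ν ∈ M the following are equivalent: (i) μ ≤_{C,+,sto} ν, i.e. ∫φ dμ ≤ ∫φ dν for every convex, non-negative, non-decreasing φ of at most linear growth; (ii) there exist η₁, η₂ ∈ M with μ ≤_C η₁, η₁ ≤_+ η₂ and η₂ ≤_sto ν. (Instance of the chain-of-relations theorem for three subscripts.) -/

import Mathlib

open MeasureTheory Set Filter ProbabilityTheory

noncomputable section

/-- A function has at most linear growth. -/
def LinGrowth (φ : ℝ → ℝ) : Prop := ∃ C : ℝ, ∀ x : ℝ, |φ x| ≤ C * (1 + |x|)

/-- Membership in `M`: finite positive Borel measure on `ℝ` with finite first moment. -/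
def MemM (μ : Measure ℝ) : Prop := IsFiniteMeasure μ ∧ Integrable (fun x => x) μ

/-- Stochastic order `≤_sto`. -/
def leSto (μ ν : Measure ℝ) : Prop :=
  ∀ φ : ℝ → ℝ, LinGrowth φ → Monotone φ → ∫ x, φ x ∂μ ≤ ∫ x, φ x ∂ν

/-- Convex order `≤_C`. -/
def leC (μ ν : Measure ℝ) : Prop :=
  ∀ φ : ℝ → ℝ, LinGrowth φ → ConvexOn ℝ Set.univ φ → ∫ x, φ x ∂μ ≤ ∫ x, φ x ∂ν

/-- Order `≤_{C,+}` (extended order). -/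
def leCP (μ ν : Measure ℝ) : Prop :=
  ∀ φ : ℝ → ℝ, LinGrowth φ → ConvexOn ℝ Set.univ φ → (∀ x, 0 ≤ φ x) →
    ∫ x, φ x ∂μ ≤ ∫ x, φ x ∂ν

/-- Order `≤_{sto,+}`. -/
def leStoP (μ ν : Measure ℝ) : Prop :=
  ∀ φ : ℝ → ℝ, LinGrowth φ → Monotone φ → (∀ x, 0 ≤ φ x) →
    ∫ x, φ x ∂μ ≤ ∫ x, φ x ∂ν

/-- Order `≤_{C,sto}`. -/
def leCS (μ ν : Measure ℝ) : Prop :=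
  ∀ φ : ℝ → ℝ, LinGrowth φ → ConvexOn ℝ Set.univ φ → Monotone φ →
    ∫ x, φ x ∂μ ≤ ∫ x, φ x ∂ν

/-- Order `≤_{C,+,sto}`. -/
def leCPS (μ ν : Measure ℝ) : Prop :=
  ∀ φ : ℝ → ℝ, LinGrowth φ → ConvexOn ℝ Set.univ φ → (∀ x, 0 ≤ φ x) → Monotone φ →
    ∫ x, φ x ∂μ ≤ ∫ x, φ x ∂ν

/-- The Kantorovich distance. -/
def W (μ ν : Measure ℝ) : ℝ :=
  sSup {d : ℝ | ∃ f : ℝ → ℝ, LipschitzWith 1 f ∧ d = |∫ x, f x ∂μ - ∫ x, f x ∂ν|}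

/-- Quantile function `G_ν`. -/
def quantile (ν : Measure ℝ) (t : ℝ) : ℝ := sInf {x : ℝ | t ≤ (ν (Set.Iic x)).toReal}

/-- `IsShadow μ ν η` means `η = S^ν(μ)`, the shadow of `μ` in `ν`. -/
def IsShadow (μ ν η : Measure ℝ) : Prop :=
  leC μ η ∧ η ≤ ν ∧ ∀ η' : Measure ℝ, leC μ η' → η' ≤ ν → leC η η'

/-- `Top(μ,ν)`: pushforward of Lebesgue measure on `(0, m]` by `max (G_μ) (G_ν)`. -/
def TopMeas (μ ν : Measure ℝ) : Measure ℝ :=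
  Measure.map (fun t => max (quantile μ t) (quantile ν t))
    (volume.restrict (Set.Ioc (0:ℝ) (μ Set.univ).toReal))

/-- `Down(μ,ν)`: pushforward of Lebesgue measure on `(0, m]` by `min (G_μ) (G_ν)`. -/
def DownMeas (μ ν : Measure ℝ) : Measure ℝ :=
  Measure.map (fun t => min (quantile μ t) (quantile ν t))
    (volume.restrict (Set.Ioc (0:ℝ) (μ Set.univ).toReal))

/-- Support of a measure on a topological space. -/
def mSupport {α : Type*} [TopologicalSpace α] [MeasurableSpace α] (μ : Measure α) : Set α :=
  {x | ∀ U ∈ nhds x, μ U ≠ 0}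

/-- Positive part (Jordan decomposition) of the signed measure `η - μ`. -/
def posPartSub (η μ : Measure ℝ) [IsFiniteMeasure η] [IsFiniteMeasure μ] : Measure ℝ :=
  (η.toSignedMeasure - μ.toSignedMeasure).toJordanDecomposition.posPart

/-- `π` is a martingale coupling of `μ` and `ν`. -/
def IsMartCoupling (π : Measure (ℝ × ℝ)) (μ ν : Measure ℝ) : Prop :=
  IsProbabilityMeasure π ∧ π.fst = μ ∧ π.snd = ν ∧
    ∀ f : ℝ → ℝ, Continuous f → (∃ C : ℝ, ∀ x, |f x| ≤ C) →
      ∫ p : ℝ × ℝ, f p.1 * (p.2 - p.1) ∂π = 0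

/-- A coupling is left-monotone. -/
def LeftMonotone (π : Measure (ℝ × ℝ)) : Prop :=
  ∃ Γ : Set (ℝ × ℝ), MeasurableSet Γ ∧ π Γ = 1 ∧
    ∀ x ym yp x' y' : ℝ, (x, ym) ∈ Γ → (x, yp) ∈ Γ → (x', y') ∈ Γ →
      x < x' → ym < yp → y' ∉ Set.Ioo ym yp

/-- The set `A` of points `x` with `π((-∞,x) × (x,∞)) = 0`. -/
def jumpSet (π : Measure (ℝ × ℝ)) : Set ℝ := {x | π (Set.Iio x ×ˢ Set.Ioi x) = 0}

/-- The set `A⁻` of points of `A` isolated on the right in `A`. -/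
def jumpSetMinus (π : Measure (ℝ × ℝ)) : Set ℝ :=
  {x ∈ jumpSet π | ∃ ε > 0, Set.Ioo x (x + ε) ∩ jumpSet π = ∅}

/-- Normalised fiber measure `π_x`. -/
def fiberMeasure (π : Measure (ℝ × ℝ)) (x : ℝ) : Measure ℝ :=
  (π.fst {x})⁻¹ • Measure.snd (π.restrict ({x} ×ˢ Set.univ))

/-- The reduced support `spt* π`. -/
def sptStar (π : Measure (ℝ × ℝ)) : Set (ℝ × ℝ) :=
  (mSupport π \ (jumpSetMinus π ×ˢ (Set.univ : Set ℝ))) ∪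
    ⋃ x ∈ {x : ℝ | 0 < π.fst {x}}, {x} ×ˢ mSupport (fiberMeasure π x)


lemma tendsto_real_Iic_atBot (μ : Measure ℝ) [IsFiniteMeasure μ] :
    Tendsto (fun x => μ.real (Iic x)) atBot (nhds 0) := by
  have h := tendsto_measure_iInter_atBot (μ := μ) (s := fun x : ℝ => Iic x)
    (fun x => measurableSet_Iic.nullMeasurableSet) monotone_Iic ⟨0, measure_ne_top _ _⟩
  have he : ⋂ x : ℝ, Iic x = ∅ := by
    ext y
    simp only [mem_iInter, mem_Iic, mem_empty_iff_false, iff_false, not_forall, not_le]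
    exact exists_lt y
  rw [he, measure_empty] at h
  exact (ENNReal.tendsto_toReal ENNReal.zero_ne_top).comp h

lemma tendsto_real_Iic_atTop (μ : Measure ℝ) [IsFiniteMeasure μ] :
    Tendsto (fun x => μ.real (Iic x)) atTop (nhds (μ.real univ)) :=
  (ENNReal.tendsto_toReal (measure_ne_top μ univ)).comp (tendsto_measure_Iic_atTop μ)

lemma tendsto_real_Iic_right (μ : Measure ℝ) [IsFiniteMeasure μ] (a : ℝ) :
    Tendsto (fun x => μ.real (Iic x)) (nhdsWithin a (Ioi a)) (nhds (μ.real (Iic a))) := by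
  have h := tendsto_measure_biInter_gt (μ := μ) (s := fun x : ℝ => Iic x) (a := a)
    (fun x _ => measurableSet_Iic.nullMeasurableSet)
    (fun i j _ hij => Iic_subset_Iic.2 hij) ⟨a + 1, by simp, measure_ne_top _ _⟩
  have he : ⋂ r : ℝ, ⋂ (_ : r > a), Iic r = Iic a := by
    ext y
    simp only [mem_iInter, mem_Iic]
    exact ⟨fun H => le_of_forall_gt_imp_ge_of_dense H, fun H r hr => H.trans hr.le⟩
  rw [he] at h
  exact (ENNReal.tendsto_toReal (measure_ne_top μ _)).comp h

/-- Galois connection between the quantile function and the distribution function. -/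
lemma quantile_le_iff (μ : Measure ℝ) [IsFiniteMeasure μ] {t x : ℝ} (ht : 0 < t)
    (htm : t < μ.real univ) : quantile μ t ≤ x ↔ t ≤ μ.real (Iic x) := by
  have hne : {x : ℝ | t ≤ (μ (Iic x)).toReal}.Nonempty :=
    ((tendsto_real_Iic_atTop μ).eventually_const_le htm).exists
  obtain ⟨b, hb⟩ := ((tendsto_real_Iic_atBot μ).eventually_lt_const ht).exists
  have hbdd : BddBelow {x : ℝ | t ≤ (μ (Iic x)).toReal} := by
    refine ⟨b, fun y hy => ?_⟩
    by_contra! hyb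
    exact absurd (hy.trans (measureReal_mono (Iic_subset_Iic.2 hyb.le))) (not_le.2 hb)
  refine ⟨fun h => ?_, fun h => csInf_le hbdd h⟩
  refine le_trans ?_ (measureReal_mono (Iic_subset_Iic.2 h))
  refine ge_of_tendsto (tendsto_real_Iic_right μ _) ?_
  filter_upwards [self_mem_nhdsWithin] with y hy
  obtain ⟨z, hz, hzy⟩ := exists_lt_of_csInf_lt hne hy
  exact le_trans hz (measureReal_mono (Iic_subset_Iic.2 hzy.le))

/-- `f` represents `μ` as a nondecreasing rearrangement on `(-μ(ℝ), 0)`. -/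
structure IsTopQuantile (f : ℝ → ℝ) (μ : Measure ℝ) : Prop where
  measurable : Measurable f
  monotoneOn : MonotoneOn f (Ioo (-μ.real univ) 0)
  eq_zero : ∀ t ∉ Ioo (-μ.real univ) 0, f t = 0
  map_eq : Measure.map f (volume.restrict (Ioo (-μ.real univ) 0)) = μ

lemma exists_isTopQuantile (μ : Measure ℝ) [IsFiniteMeasure μ] :
    ∃ f, IsTopQuantile f μ := by
  set m := μ.real univ with hm
  set f : ℝ → ℝ := (Ioo (-m) 0).indicator fun t => quantile μ (t + m) with hf
  have hle : ∀ t ∈ Ioo (-m) 0, ∀ x, f t ≤ x ↔ t ≤ μ.real (Iic x) - m := by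
    intro t ht x
    rw [hf, indicator_of_mem ht, quantile_le_iff μ (by linarith [ht.1]) (by linarith [ht.2]),
      le_sub_iff_add_le]
  have hmeas : Measurable f := by
    refine measurable_of_Iic fun x => ?_
    have : f ⁻¹' Iic x = (Ioo (-m) 0 ∩ Iic (μ.real (Iic x) - m)) ∪
        ((Ioo (-m) 0)ᶜ ∩ {_t | (0 : ℝ) ≤ x}) := by
      ext t
      by_cases ht : t ∈ Ioo (-m) 0
      · simp only [mem_preimage, mem_Iic, hle t ht, mem_union, mem_inter_iff, ht, true_and,
          mem_compl_iff, not_true, false_and, or_false]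
      · simp only [mem_preimage, mem_Iic, hf, indicator_of_notMem ht, mem_union, mem_inter_iff, ht,
          false_and, mem_compl_iff, not_false_iff, true_and, false_or, mem_ofPred_eq]
    rw [this]
    exact (measurableSet_Ioo.inter measurableSet_Iic).union
      (measurableSet_Ioo.compl.inter (MeasurableSet.const _))
  refine ⟨f, hmeas, fun s hs t ht hst => ?_, fun t ht => indicator_of_notMem ht _, ?_⟩
  · exact (hle s hs _).2 (hst.trans ((hle t ht _).1 le_rfl))
  · symm
    refine Measure.ext_of_Iic _ _ fun x => ?_
    have hx0 : 0 ≤ μ.real (Iic x) := measureReal_nonneg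
    have hxm : μ.real (Iic x) ≤ m := measureReal_mono (subset_univ _)
    have hset : (f ⁻¹' Iic x ∩ Ioo (-m) 0 : Set ℝ) =ᵐ[volume]
        (Ioc (-m) (μ.real (Iic x) - m) : Set ℝ) := by
      have h1 : f ⁻¹' Iic x ∩ Ioo (-m) 0 = Iic (μ.real (Iic x) - m) ∩ Ioo (-m) 0 := by
        ext t
        simp only [mem_inter_iff, mem_preimage, mem_Iic]
        exact and_congr_left fun ht => hle t ht x
      have h2 : Ioc (-m) (μ.real (Iic x) - m) = Iic (μ.real (Iic x) - m) ∩ Ioc (-m) 0 := by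
        ext t
        simp only [mem_inter_iff, mem_Iic, mem_Ioc]
        constructor
        · rintro ⟨h, h'⟩; exact ⟨h', h, by linarith⟩
        · rintro ⟨h, h', -⟩; exact ⟨h', h⟩
      rw [h1, h2]
      exact ae_eq_set_inter (ae_eq_refl (Iic (μ.real (Iic x) - m))) Ioo_ae_eq_Ioc
    rw [Measure.map_apply hmeas measurableSet_Iic,
      Measure.restrict_apply (hmeas measurableSet_Iic), measure_congr hset, Real.volume_Ioc]
    simp

lemma MemM.integrable_comp {μ : Measure ℝ} (hμ : MemM μ) {φ : ℝ → ℝ} (hφ : LinGrowth φ)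
    (hm : Measurable φ) : Integrable φ μ := by
  obtain ⟨C, hC⟩ := hφ
  have := hμ.1
  refine Integrable.mono' (g := fun x => C * (1 + |x|))
    (((integrable_const 1).add hμ.2.abs).const_mul C) hm.aestronglyMeasurable
    (ae_of_all _ hC)

lemma ConvexOn.measurable_univ {φ : ℝ → ℝ} (h : ConvexOn ℝ univ φ) : Measurable φ :=
  (continuousOn_univ.1 (h.continuousOn isOpen_univ)).measurable

/-- A convex function of linear growth becomes nondecreasing after adding a linear function. -/
lemma ConvexOn.exists_monotone_add_linear {φ : ℝ → ℝ} (hφ : ConvexOn ℝ univ φ)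
    (hl : LinGrowth φ) : ∃ K : ℝ, Monotone fun x => φ x + K * x := by
  obtain ⟨C, hC⟩ := hl
  refine ⟨C, monotone_iff_forall_lt.2 fun x y hxy => ?_⟩
  have key : ∀ z < x, z < 0 → -(C * (1 + |x|) + C * (1 - z)) / (x - z) ≤ (φ y - φ x) / (y - x) := by
    intro z hz hz0
    refine le_trans ?_ (hφ.slope_mono_adjacent (mem_univ z) (mem_univ y) hz hxy)
    have h1 := (abs_le.1 (hC x)).1
    have h2 := (abs_le.1 (hC z)).2
    rw [abs_of_neg hz0] at h2
    gcongr
    linarith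
  have hlim : Tendsto (fun z : ℝ => -(C * (1 + |x|) + C * (1 - z)) / (x - z)) atBot
      (nhds (-C)) := by
    have h0 : Tendsto (fun z : ℝ => (x - z)⁻¹) atBot (nhds 0) :=
      tendsto_inv_atTop_zero.comp (tendsto_atTop_add_const_left _ x tendsto_neg_atBot_atTop)
    have h1 : Tendsto (fun z : ℝ => -C + -(C * (1 + |x|) + C * (1 - x)) * (x - z)⁻¹) atBot
        (nhds (-C + -(C * (1 + |x|) + C * (1 - x)) * 0)) := (h0.const_mul _).const_add _
    rw [mul_zero, add_zero] at h1
    refine h1.congr' ?_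
    filter_upwards [eventually_lt_atBot x] with z hz
    have : x - z ≠ 0 := by linarith
    field_simp
    ring
  have hge : -C ≤ (φ y - φ x) / (y - x) := by
    refine le_of_tendsto hlim ?_
    filter_upwards [eventually_lt_atBot x, eventually_lt_atBot 0] with z hz hz0
    exact key z hz hz0
  rw [le_div_iff₀ (by linarith)] at hge
  linarith

lemma LinGrowth.add_linear {φ : ℝ → ℝ} (h : LinGrowth φ) (a b : ℝ) :
    LinGrowth fun x => φ x + (a * x + b) := by
  obtain ⟨C, hC⟩ := h
  refine ⟨C + |a| + |b|, fun x => ?_⟩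
  have h1 : |φ x + (a * x + b)| ≤ |φ x| + (|a| * |x| + |b|) :=
    (abs_add_le _ _).trans (by gcongr; exact (abs_add_le _ _).trans (by rw [abs_mul]))
  nlinarith [hC x, abs_nonneg a, abs_nonneg b, abs_nonneg x,
    mul_nonneg (abs_nonneg b) (abs_nonneg x)]

lemma LinGrowth.max_const {φ : ℝ → ℝ} (h : LinGrowth φ) (c : ℝ) :
    LinGrowth fun x => max (φ x) c := by
  obtain ⟨C, hC⟩ := h
  refine ⟨C + |c|, fun x => ?_⟩
  have h1 : |max (φ x) c| ≤ |φ x| + |c| :=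
    abs_max_le_max_abs_abs.trans (max_le (by linarith [abs_nonneg c]) (by linarith [abs_nonneg (φ x)]))
  nlinarith [hC x, abs_nonneg c, abs_nonneg x, mul_nonneg (abs_nonneg c) (abs_nonneg x)]

lemma convexOn_linear (a b : ℝ) : ConvexOn ℝ univ fun x : ℝ => a * x + b := by
  refine ⟨convex_univ, fun x _ y _ s t _ _ hst => le_of_eq ?_⟩
  simp only [smul_eq_mul]
  linear_combination -b * hst

lemma leCPS.leCS_of_univ_eq {μ ν : Measure ℝ} (hμ : MemM μ) (hν : MemM ν)
    (hmass : μ.real univ = ν.real univ) (h : leCPS μ ν) : leCS μ ν := by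
  intro φ hl hc hm
  have := hμ.1
  have := hν.1
  have hlim : ∀ ρ : Measure ℝ, MemM ρ → Tendsto (fun k : ℕ => ∫ x, max (φ x) (-(k : ℝ)) ∂ρ) atTop
      (nhds (∫ x, φ x ∂ρ)) := by
    intro ρ hρ
    refine tendsto_integral_of_dominated_convergence (fun x => |φ x|)
      (fun k => (hm.measurable.max measurable_const).aestronglyMeasurable)
      (hρ.integrable_comp hl hm.measurable).abs (fun k => ae_of_all _ fun x => ?_)
      (ae_of_all _ fun x => ?_)
    · rw [Real.norm_eq_abs]
      have hk : (0 : ℝ) ≤ k := Nat.cast_nonneg k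
      rcases le_total (φ x) (-(k : ℝ)) with hx | hx
      · rw [max_eq_right hx, abs_neg, abs_of_nonneg hk, abs_of_nonpos (by linarith)]
        linarith
      · rw [max_eq_left hx]
    · refine tendsto_const_nhds.congr' ?_
      obtain ⟨N, hN⟩ := exists_nat_ge (-(φ x))
      filter_upwards [eventually_ge_atTop N] with k hk
      have : (N : ℝ) ≤ k := Nat.cast_le.2 hk
      rw [max_eq_left (by linarith)]
  refine le_of_tendsto_of_tendsto' (hlim μ hμ) (hlim ν hν) fun k => ?_
  have hcx : ConvexOn ℝ univ fun x => max (φ x) (-(k : ℝ)) := hc.sup (convexOn_const _ convex_univ)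
  have hmono : Monotone fun x => max (φ x) (-(k : ℝ)) := hm.max monotone_const
  have hk := h (fun x => max (φ x) (-(k : ℝ)) + k)
    (by simpa using (hl.max_const (-(k : ℝ))).add_linear 0 k) (hcx.add_const _)
    (fun x => by linarith [le_max_right (φ x) (-(k : ℝ))]) (hmono.add_const _)
  rw [integral_add (hμ.integrable_comp (hl.max_const _) hmono.measurable) (integrable_const _),
    integral_add (hν.integrable_comp (hl.max_const _) hmono.measurable) (integrable_const _),
    integral_const, integral_const, hmass] at hk
  linarith

lemma leCS.leC_of_mean_eq {μ ν : Measure ℝ} (hμ : MemM μ) (hν : MemM ν)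
    (hmean : ∫ x, x ∂μ = ∫ x, x ∂ν) (h : leCS μ ν) : leC μ ν := by
  intro φ hl hc
  obtain ⟨K, hK⟩ := hc.exists_monotone_add_linear hl
  have hk := h (fun x => φ x + K * x) (by simpa using hl.add_linear K 0)
    (hc.add (by simpa using convexOn_linear K 0)) hK
  rw [integral_add (hμ.integrable_comp hl hc.measurable_univ) (hμ.2.const_mul K),
    integral_add (hν.integrable_comp hl hc.measurable_univ) (hν.2.const_mul K),
    integral_const_mul, integral_const_mul, hmean] at hk
  linarith

/-- Existence of a supporting line. -/
lemma ConvexOn.exists_subgradient {φ : ℝ → ℝ} (hφ : ConvexOn ℝ univ φ) (x₀ : ℝ) :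
    ∃ p : ℝ, ∀ x, φ x₀ + p * (x - x₀) ≤ φ x := by
  have hi : x₀ ∈ interior (univ : Set ℝ) := by simp
  refine ⟨derivWithin φ (Ioi x₀) x₀, fun x => ?_⟩
  rcases lt_trichotomy x x₀ with hx | rfl | hx
  · have h1 := (hφ.slope_le_leftDeriv (mem_univ x) (mem_univ x₀) hx
      (hφ.hasDerivWithinAt_leftDeriv_of_mem_interior hi).differentiableWithinAt).trans
      (hφ.leftDeriv_le_rightDeriv_of_mem_interior hi)
    rw [slope_def_field, div_le_iff₀ (by linarith)] at h1
    linarith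
  · simp
  · have h1 := hφ.rightDeriv_le_slope (mem_univ x₀) (mem_univ x) hx
      (hφ.hasDerivWithinAt_rightDeriv_of_mem_interior hi).differentiableWithinAt
    rw [slope_def_field, le_div_iff₀ (by linarith)] at h1
    linarith

lemma LinGrowth.integrableOn_comp {φ f : ℝ → ℝ} (hφ : LinGrowth φ) (hm : Measurable φ)
    (hfm : Measurable f) (hf : Integrable f) (a b : ℝ) :
    IntegrableOn (fun t => φ (f t)) (Ioo a b) := by
  obtain ⟨C, hC⟩ := hφ
  refine Integrable.mono' (g := fun t => C * (1 + |f t|))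
    (((integrable_const 1).add hf.restrict.abs).const_mul C)
    (hm.comp hfm).aestronglyMeasurable (ae_of_all _ fun t => hC (f t))

lemma memM_map {f : ℝ → ℝ} (hfm : Measurable f) (hf : Integrable f) (a b : ℝ) :
    MemM (Measure.map f (volume.restrict (Ioo a b))) :=
  ⟨inferInstance,
    (integrable_map_measure measurable_id.aestronglyMeasurable hfm.aemeasurable).2 hf.restrict⟩

lemma integral_map_restrict {φ f : ℝ → ℝ} (hm : Measurable φ) (hfm : Measurable f) (s : Set ℝ) :
    ∫ x, φ x ∂(Measure.map f (volume.restrict s)) = ∫ t in s, φ (f t) :=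
  integral_map hfm.aemeasurable hm.aestronglyMeasurable

lemma real_map_restrict_univ {f : ℝ → ℝ} (hfm : Measurable f) {a b : ℝ} (hab : a ≤ b) :
    (Measure.map f (volume.restrict (Ioo a b))).real univ = b - a := by
  rw [map_measureReal_apply hfm MeasurableSet.univ]
  simp [hab]

namespace IsTopQuantile

variable {f : ℝ → ℝ} {μ : Measure ℝ}

lemma integrable (hf : IsTopQuantile f μ) (hμ : MemM μ) : Integrable f := by
  have h : IntegrableOn f (Ioo (-μ.real univ) 0) := by
    have h1 := hμ.2
    rw [← hf.map_eq] at h1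
    exact (integrable_map_measure measurable_id.aestronglyMeasurable hf.measurable.aemeasurable).1 h1
  refine (integrableOn_iff_integrable_of_support_subset fun t ht => ?_).1 h
  by_contra hn
  exact ht (hf.eq_zero t hn)

lemma setIntegral_comp (hf : IsTopQuantile f μ) {φ : ℝ → ℝ} (hm : Measurable φ) :
    ∫ t in Ioo (-μ.real univ) 0, φ (f t) = ∫ x, φ x ∂μ := by
  rw [← integral_map_restrict hm hf.measurable, hf.map_eq]

end IsTopQuantile

lemma leCPS.map_restrict_tail {μ ν : Measure ℝ} {f g : ℝ → ℝ} (hμ : MemM μ) (hν : MemM ν)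
    (hf : IsTopQuantile f μ) (hg : IsTopQuantile g ν) (h : leCPS μ ν)
    (hmass : μ.real univ ≤ ν.real univ) {r : ℝ} (hr : -μ.real univ ≤ r) :
    leCPS (Measure.map f (volume.restrict (Ioo r 0)))
      (Measure.map g (volume.restrict (Ioo r 0))) := by
  rcases le_or_gt 0 r with hr0 | hr0
  · simp only [Ioo_eq_empty (not_lt.2 hr0), Measure.restrict_empty, Measure.map_zero]
    exact fun _ _ _ _ _ => le_rfl
  intro φ hl hc h0 hm
  have hcm := hm.measurable
  have hfi := hf.integrable hμ
  have hgi := hg.integrable hν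
  rw [integral_map_restrict hcm hf.measurable, integral_map_restrict hcm hg.measurable]
  set c := sInf ((fun t => φ (g t)) '' Ioo r 0) with hcdef
  have hcle : ∀ t ∈ Ioo r 0, c ≤ φ (g t) := fun t ht =>
    csInf_le ⟨0, by rintro _ ⟨s, -, rfl⟩; exact h0 _⟩ ⟨t, ht, rfl⟩
  have hlec : ∀ t ∈ Ioo (-ν.real univ) 0, t ≤ r → φ (g t) ≤ c := by
    intro t ht htr
    refine le_csInf ((nonempty_Ioo.2 hr0).image _) ?_
    rintro _ ⟨s, hs, rfl⟩
    exact hm (hg.monotoneOn ht ⟨ht.1.trans_le (htr.trans hs.1.le), hs.2⟩ (htr.trans hs.1.le))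
  set χ : ℝ → ℝ := fun x => max (φ x + -c) 0 with hχ
  have hχl : LinGrowth χ := by
    have := (hl.add_linear 0 (-c)).max_const 0
    simpa [hχ] using this
  have hχc : ConvexOn ℝ univ χ := (hc.add_const _).sup (convexOn_const _ convex_univ)
  have hχm : Monotone χ := (hm.add_const _).max monotone_const
  have hχχ := h χ hχl hχc (fun x => le_max_right _ _) hχm
  rw [← hf.setIntegral_comp hχm.measurable, ← hg.setIntegral_comp hχm.measurable] at hχχ
  have hφf := hl.integrableOn_comp hcm hf.measurable hfi r 0
  have hφg := hl.integrableOn_comp hcm hg.measurable hgi r 0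
  have hconst : IntegrableOn (fun _ : ℝ => -c) (Ioo r 0) := integrable_const _
  have h1 : ∫ t in Ioo r 0, (φ (f t) + -c) ≤ ∫ t in Ioo r 0, χ (f t) :=
    setIntegral_mono_on (hφf.add hconst)
      (hχl.integrableOn_comp hχm.measurable hf.measurable hfi r 0) measurableSet_Ioo
      fun t _ => le_max_left _ _
  have h2 : ∫ t in Ioo r 0, χ (f t) ≤ ∫ t in Ioo (-μ.real univ) 0, χ (f t) :=
    setIntegral_mono_set (hχl.integrableOn_comp hχm.measurable hf.measurable hfi _ 0)
      (ae_of_all _ fun t => le_max_right _ _) (Ioo_subset_Ioo_left hr).eventuallyLE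
  have h3 : ∫ t in Ioo (-ν.real univ) 0, χ (g t) = ∫ t in Ioo r 0, χ (g t) := by
    refine setIntegral_eq_of_subset_of_forall_sdiff_eq_zero measurableSet_Ioo
      (Ioo_subset_Ioo_left (by linarith)) fun t ht => ?_
    have htr : t ≤ r := by
      by_contra! hlt
      exact ht.2 ⟨hlt, ht.1.2⟩
    exact max_eq_right (by linarith [hlec t ht.1 htr])
  have h4 : ∫ t in Ioo r 0, χ (g t) = ∫ t in Ioo r 0, (φ (g t) + -c) :=
    setIntegral_congr_fun measurableSet_Ioo fun t ht =>
      max_eq_left (by linarith [hcle t ht])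
  rw [integral_add hφf hconst] at h1
  rw [integral_add hφg hconst] at h4
  linarith

lemma ConvexOn.monotoneOn_Ici_of_isMin {θ : ℝ → ℝ} {x₀ : ℝ} (h : ConvexOn ℝ univ θ)
    (hmin : ∀ x, θ x₀ ≤ θ x) : MonotoneOn θ (Ici x₀) := fun _ hx y _ hxy =>
  (h.le_max_of_mem_Icc (mem_univ x₀) (mem_univ y) ⟨hx, hxy⟩).trans (max_le (hmin y) le_rfl)

lemma ConvexOn.antitoneOn_Iic_of_isMin {θ : ℝ → ℝ} {x₀ : ℝ} (h : ConvexOn ℝ univ θ)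
    (hmin : ∀ x, θ x₀ ≤ θ x) : AntitoneOn θ (Iic x₀) := fun x _ _ hy hxy =>
  (h.le_max_of_mem_Icc (mem_univ x) (mem_univ x₀) ⟨hxy, hy⟩).trans (max_le le_rfl (hmin x))

/-- Lowering the bottom part of a quantile function and keeping a part that dominates the top
part produces a larger measure in convex order, provided the means agree. -/
lemma leC_map_of_lower_bottom {μ : Measure ℝ} {f g H : ℝ → ℝ} (hμ : MemM μ)
    (hf : IsTopQuantile f μ) (hgm : Measurable g) (hgi : Integrable g) (hHm : Measurable H)
    (hHi : Integrable H) {r : ℝ} (hr : r ∈ Ioo (-μ.real univ) 0)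
    (htail : leCPS (Measure.map f (volume.restrict (Ioo r 0)))
      (Measure.map g (volume.restrict (Ioo r 0))))
    (hbot : ∀ t ∈ Ioc (-μ.real univ) r, H t ≤ f t) (htop : ∀ t ∈ Ioo r 0, H t = g t)
    (hmean : ∫ t in Ioo (-μ.real univ) 0, H t = ∫ t in Ioo (-μ.real univ) 0, f t) :
    leC μ (Measure.map H (volume.restrict (Ioo (-μ.real univ) 0))) := by
  intro φ hl hc
  have hfi := hf.integrable hμ
  have hcm := hc.measurable_univ
  rw [← hf.setIntegral_comp hcm, integral_map_restrict hcm hHm]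
  obtain ⟨p, hp⟩ := hc.exists_subgradient (f r)
  set b := p * f r - φ (f r) with hb
  set θ : ℝ → ℝ := fun x => φ x + (-p * x + b) with hθ
  have hθ0 : θ (f r) = 0 := by simp only [hθ, hb]; ring
  have hθpos : ∀ x, 0 ≤ θ x := fun x => by
    simp only [hθ, hb]
    linarith [hp x]
  have hθmin : ∀ x, θ (f r) ≤ θ x := fun x => hθ0 ▸ hθpos x
  have hθl : LinGrowth θ := hl.add_linear (-p) b
  have hθc : ConvexOn ℝ univ θ := hc.add (convexOn_linear (-p) b)
  have hθm := hθc.measurable_univ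
  have hmono := hθc.monotoneOn_Ici_of_isMin hθmin
  have hanti := hθc.antitoneOn_Iic_of_isMin hθmin
  set ψ : ℝ → ℝ := fun x => θ (max x (f r)) with hψ
  have hψmono : Monotone ψ := fun x y hxy =>
    hmono (mem_Ici.2 (le_max_right _ _)) (mem_Ici.2 (le_max_right _ _))
      (max_le_max_right _ hxy)
  have hψle : ∀ x, ψ x ≤ θ x := by
    intro x
    rcases le_total x (f r) with hx | hx
    · simp only [hψ, max_eq_right hx, hθmin x]
    · simp only [hψ, max_eq_left hx, le_refl]
  have hψl : LinGrowth ψ := by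
    obtain ⟨C, hC⟩ := hθl
    refine ⟨C, fun x => ?_⟩
    rw [abs_of_nonneg (hθpos _)]
    exact (hψle x).trans ((le_abs_self _).trans (hC x))
  have hψc : ConvexOn ℝ univ ψ := by
    have hmax : ConvexOn ℝ univ fun x : ℝ => max x (f r) :=
      (convexOn_id convex_univ).sup (convexOn_const _ convex_univ)
    have himg : (fun x : ℝ => max x (f r)) '' univ ⊆ Ici (f r) := by
      rintro _ ⟨x, -, rfl⟩
      exact mem_Ici.2 (le_max_right _ _)
    have hcv : Convex ℝ ((fun x : ℝ => max x (f r)) '' univ) := by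
      have : (fun x : ℝ => max x (f r)) '' univ = Ici (f r) :=
        himg.antisymm fun y hy => ⟨y, mem_univ _, max_eq_left hy⟩
      rw [this]
      exact convex_Ici _
    exact (hθc.subset (subset_univ _) hcv).comp hmax (hmono.mono himg)
  have hunion : Ioo (-μ.real univ) 0 = Ioc (-μ.real univ) r ∪ Ioo r 0 :=
    (Ioc_union_Ioo_eq_Ioo hr.1.le hr.2).symm
  have hdisj : Disjoint (Ioc (-μ.real univ) r) (Ioo r 0) :=
    disjoint_left.2 fun t ht ht' => not_lt.2 ht.2 ht'.1
  have hif := hθl.integrableOn_comp hθm hf.measurable hfi (-μ.real univ) 0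
  have hiH := hθl.integrableOn_comp hθm hHm hHi (-μ.real univ) 0
  have hsub1 : Ioc (-μ.real univ) r ⊆ Ioo (-μ.real univ) 0 := fun t ht =>
    ⟨ht.1, ht.2.trans_lt hr.2⟩
  have hsub2 : Ioo r 0 ⊆ Ioo (-μ.real univ) 0 := Ioo_subset_Ioo_left hr.1.le
  have hbottom : ∫ t in Ioc (-μ.real univ) r, θ (f t) ≤ ∫ t in Ioc (-μ.real univ) r, θ (H t) := by
    refine setIntegral_mono_on (hif.mono_set hsub1) (hiH.mono_set hsub1) measurableSet_Ioc
      fun t ht => ?_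
    have hft : f t ≤ f r := hf.monotoneOn (hsub1 ht) hr ht.2
    exact hanti (mem_Iic.2 ((hbot t ht).trans hft)) (mem_Iic.2 hft) (hbot t ht)
  have htopi : ∫ t in Ioo r 0, θ (f t) ≤ ∫ t in Ioo r 0, θ (H t) := by
    have h1 : ∫ t in Ioo r 0, θ (f t) = ∫ t in Ioo r 0, ψ (f t) :=
      setIntegral_congr_fun measurableSet_Ioo fun t ht => by
        simp only [hψ, max_eq_left (hf.monotoneOn hr (hsub2 ht) ht.1.le)]
    have h2 := htail ψ hψl hψc (fun x => hθpos _) hψmono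
    rw [integral_map_restrict hψmono.measurable hf.measurable,
      integral_map_restrict hψmono.measurable hgm] at h2
    have h3 : ∫ t in Ioo r 0, ψ (g t) ≤ ∫ t in Ioo r 0, θ (H t) :=
      setIntegral_mono_on (hψl.integrableOn_comp hψmono.measurable hgm hgi r 0)
        (hiH.mono_set hsub2) measurableSet_Ioo fun t ht => by
          rw [htop t ht]
          exact hψle _
    exact h1.le.trans (h2.trans h3)
  have htotal : ∫ t in Ioo (-μ.real univ) 0, θ (f t) ≤ ∫ t in Ioo (-μ.real univ) 0, θ (H t) := by
    rw [hunion, setIntegral_union hdisj measurableSet_Ioo (hif.mono_set hsub1)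
      (hif.mono_set hsub2), setIntegral_union hdisj measurableSet_Ioo (hiH.mono_set hsub1)
      (hiH.mono_set hsub2)]
    exact add_le_add hbottom htopi
  have hexp : ∀ k : ℝ → ℝ, Measurable k → Integrable k →
      ∫ t in Ioo (-μ.real univ) 0, θ (k t) = (∫ t in Ioo (-μ.real univ) 0, φ (k t)) +
        (-p * (∫ t in Ioo (-μ.real univ) 0, k t) + ∫ _t in Ioo (-μ.real univ) 0, b) := by
    intro k hkm hki
    have hb' : IntegrableOn (fun _ : ℝ => b) (Ioo (-μ.real univ) 0) := integrable_const _
    have hk' : IntegrableOn (fun t => -p * k t) (Ioo (-μ.real univ) 0) :=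
      hki.restrict.const_mul _
    have hkb : IntegrableOn (fun t => -p * k t + b) (Ioo (-μ.real univ) 0) := hk'.add hb'
    rw [← integral_const_mul, ← integral_add hk' hb',
      ← integral_add (hl.integrableOn_comp hcm hkm hki _ _) hkb]
  rw [hexp f hf.measurable hfi, hexp H hHm hHi, hmean] at htotal
  linarith

lemma exists_lowered_quantile {μ ν : Measure ℝ} {f g : ℝ → ℝ} (hμ : MemM μ) (hν : MemM ν)
    (hf : IsTopQuantile f μ) (hg : IsTopQuantile g ν) (h : leCPS μ ν)
    (hmass : μ.real univ ≤ ν.real univ) :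
    ∃ H : ℝ → ℝ, Measurable H ∧ Integrable H ∧ (∀ t, H t ≤ g t) ∧
      leC μ (Measure.map H (volume.restrict (Ioo (-μ.real univ) 0))) := by
  have hfi := hf.integrable hμ
  have hgi := hg.integrable hν
  set m := μ.real univ with hm
  have hm0 : 0 ≤ m := measureReal_nonneg
  have htail : ∀ r, -m ≤ r → leCPS (Measure.map f (volume.restrict (Ioo r 0)))
      (Measure.map g (volume.restrict (Ioo r 0))) := fun r hr =>
    h.map_restrict_tail hμ hν hf hg hmass hr
  have hCS : leCS μ (Measure.map g (volume.restrict (Ioo (-m) 0))) := by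
    have h1 := htail (-m) le_rfl
    rw [hf.map_eq] at h1
    exact h1.leCS_of_univ_eq hμ (memM_map hg.measurable hgi _ _)
      (by rw [real_map_restrict_univ hg.measurable (by linarith)]; simp [hm])
  set D : ℝ → ℝ := fun t => max (g t - f t) 0 with hD
  set E : ℝ → ℝ := fun t => max (f t - g t) 0 with hE
  have hDi : Integrable D := (hgi.sub hfi).pos_part
  have hEi : Integrable E := (hfi.sub hgi).pos_part
  have hfE : Integrable fun t => f t - E t := hfi.sub hEi
  have hDE : ∀ t, g t = f t - E t + D t := by
    intro t
    simp only [hD, hE]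
    rcases le_total (f t) (g t) with hh | hh
    · rw [max_eq_right (sub_nonpos.2 hh), max_eq_left (sub_nonneg.2 hh)]; ring
    · rw [max_eq_left (sub_nonneg.2 hh), max_eq_right (sub_nonpos.2 hh)]; ring
  have hminE : ∀ t, min (f t) (g t) = f t - E t := by
    intro t
    simp only [hE]
    rcases le_total (f t) (g t) with hh | hh
    · rw [max_eq_right (sub_nonpos.2 hh), min_eq_left hh]; ring
    · rw [max_eq_left (sub_nonneg.2 hh), min_eq_right hh]; ring
  have hmean : ∫ t in Ioo (-m) 0, f t ≤ ∫ t in Ioo (-m) 0, g t := by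
    have h1 := hCS (fun x => x) ⟨1, fun x => by linarith [abs_nonneg x]⟩
      (convexOn_id convex_univ) monotone_id
    rwa [integral_map_restrict measurable_id' hg.measurable,
      ← hf.setIntegral_comp measurable_id'] at h1
  have hJcont : ContinuousOn (fun r => ∫ t in r..0, D t) (Icc (-m) 0) := by
    have := intervalIntegral.continuousOn_primitive_interval_left (a := -m) (b := 0)
      (μ := volume) hDi.integrableOn
    rwa [uIcc_of_le (by linarith)] at this
  have hJ : ∀ r ≤ 0, ∫ t in r..0, D t = ∫ t in Ioo r 0, D t := fun r hr => by
    rw [intervalIntegral.integral_of_le hr, integral_Ioc_eq_integral_Ioo]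
  have hivt := intermediate_value_Icc' (by linarith : -m ≤ 0) hJcont
  obtain ⟨r, ⟨hr1, hr2⟩, hr⟩ : ∫ t in Ioo (-m) 0, E t ∈ (fun r => ∫ t in r..0, D t) '' Icc (-m) 0 := by
    refine hivt ⟨?_, ?_⟩
    · simp only [intervalIntegral.integral_same]
      exact integral_nonneg fun t => le_max_right _ _
    · simp only [hJ (-m) (by linarith)]
      have h1 : ∫ t in Ioo (-m) 0, g t = ∫ t in Ioo (-m) 0, (f t - E t + D t) :=
        integral_congr_ae (ae_of_all _ hDE)
      rw [integral_add hfE.restrict hDi.restrict,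
        integral_sub hfi.restrict hEi.restrict] at h1
      linarith
  simp only [hJ r hr2] at hr
  set H : ℝ → ℝ := (Ioc (-m) r).piecewise (fun t => min (f t) (g t)) g with hH
  have hHm : Measurable H := (hf.measurable.min hg.measurable).piecewise measurableSet_Ioc
    hg.measurable
  have hHi : Integrable H := Integrable.piecewise measurableSet_Ioc
    (hfi.inf hgi).integrableOn hgi.integrableOn
  have hHin : ∀ t ∈ Ioc (-m) r, H t = min (f t) (g t) := fun t ht => piecewise_eq_of_mem _ _ _ ht
  have hHout : ∀ t ∉ Ioc (-m) r, H t = g t := fun t ht => piecewise_eq_of_notMem _ _ _ ht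
  have hHtop : ∀ t ∈ Ioo r 0, H t = g t := fun t ht => hHout t fun h' => not_lt.2 h'.2 ht.1
  have hHmean : ∫ t in Ioo (-m) 0, H t = ∫ t in Ioo (-m) 0, f t := by
    have h1 : ∫ t in Ioo (-m) 0, H t =
        ∫ t in Ioo (-m) 0, (f t - E t + (Ioo r 0).indicator D t) := by
      refine setIntegral_congr_fun measurableSet_Ioo fun t ht => ?_
      by_cases htr : t ≤ r
      · rw [hHin t ⟨ht.1, htr⟩, hminE, indicator_of_notMem fun h' => not_lt.2 htr h'.1, add_zero]
      · have htr' : t ∈ Ioo r 0 := ⟨not_le.1 htr, ht.2⟩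
        rw [hHtop t htr', indicator_of_mem htr', ← hDE]
    rw [h1, integral_add hfE.restrict
      (hDi.indicator measurableSet_Ioo).restrict, integral_sub hfi.restrict hEi.restrict,
      setIntegral_indicator measurableSet_Ioo,
      inter_eq_self_of_subset_right (Ioo_subset_Ioo_left hr1), hr]
    ring
  refine ⟨H, hHm, hHi, fun t => ?_, ?_⟩
  · by_cases ht : t ∈ Ioc (-m) r
    · exact (hHin t ht).trans_le (min_le_right _ _)
    · exact (hHout t ht).le
  have hMH := memM_map hHm hHi (-m) 0
  have hmean' : ∫ x, x ∂μ = ∫ x, x ∂(Measure.map H (volume.restrict (Ioo (-m) 0))) := by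
    rw [integral_map_restrict measurable_id' hHm, hHmean]
    exact (hf.setIntegral_comp measurable_id').symm
  rcases hr2.eq_or_lt with rfl | hr2'
  · have hle : H ≤ᵐ[volume.restrict (Ioo (-m) 0)] f := by
      filter_upwards [ae_restrict_mem measurableSet_Ioo] with t ht
      exact (hHin t ⟨ht.1, ht.2.le⟩).trans_le (min_le_left _ _)
    have hae := (integral_eq_iff_of_ae_le hHi.restrict hfi.restrict hle).1 hHmean
    rw [Measure.map_congr hae, hf.map_eq]
    exact fun _ _ _ => le_rfl
  rcases hr1.eq_or_lt with rfl | hr1'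
  · have hae : H = g := funext fun t => hHout t (by simp)
    rw [hae] at hmean' hMH ⊢
    exact hCS.leC_of_mean_eq hμ hMH hmean'
  · exact leC_map_of_lower_bottom hμ hf hg.measurable hgi hHm hHi ⟨hr1', hr2'⟩ (htail r hr1)
      (fun t ht => (hHin t ht).trans_le (min_le_left _ _)) hHtop hHmean

/-- decomposition of the order `≤_{C,+,sto}` in three steps. -/
theorem leCPS_iff_decomposition (μ ν : Measure ℝ) (hμ : MemM μ) (hν : MemM ν) :
    leCPS μ ν ↔ ∃ η₁ η₂ : Measure ℝ, MemM η₁ ∧ MemM η₂ ∧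
      leC μ η₁ ∧ η₁ ≤ η₂ ∧ leSto η₂ ν := by
  constructor
  · intro h
    have := hμ.1
    have := hν.1
    have hmass : μ.real univ ≤ ν.real univ := by
      simpa using h (fun _ => 1) ⟨1, fun x => by simp⟩ (convexOn_const _ convex_univ)
        (fun _ => zero_le_one) monotone_const
    obtain ⟨f, hf⟩ := exists_isTopQuantile μ
    obtain ⟨g, hg⟩ := exists_isTopQuantile ν
    obtain ⟨H, hHm, hHi, hHg, hC⟩ := exists_lowered_quantile hμ hν hf hg h hmass
    refine ⟨_, Measure.map H (volume.restrict (Ioo (-ν.real univ) 0)), memM_map hHm hHi _ _,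
      memM_map hHm hHi _ _, hC, Measure.map_mono (Measure.restrict_mono
        (Ioo_subset_Ioo_left (neg_le_neg hmass)) le_rfl) hHm, fun φ hl hm => ?_⟩
    rw [integral_map_restrict hm.measurable hHm, ← hg.setIntegral_comp hm.measurable]
    exact setIntegral_mono_on (hl.integrableOn_comp hm.measurable hHm hHi _ _)
      (hl.integrableOn_comp hm.measurable hg.measurable (hg.integrable hν) _ _) measurableSet_Ioo
      fun t _ => hm (hHg t)
  · rintro ⟨η₁, η₂, -, hη₂, h₁, h₂, h₃⟩ φ hl hc h0 hm
    exact (h₁ φ hl hc).trans ((integral_mono_measure h₂ (ae_of_all _ h0)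
      (hη₂.integrable_comp hl hm.measurable)).trans (h₃ φ hl hm))

end
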